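/- Let c, k, λ, β > 0 and let f_BW(x) = e^{-(x/λ)^β} [ c k x^{-c-1} (1+x^{-c})^{-k-1} + (β/λ^β) x^{β-1} (1 - (1+x^{-c})^{-k}) ] for x > 0. Then ∫_{0}^{∞} f_BW(x) dx = 1, i.e. f_BW is a probability density function on (0, ∞). -/

import Mathlib

open MeasureTheory

open Set Filter Topology

/-- The Burr III distribution function, rewritten in a form that is continuous at `0`. -/
lemma one_add_rpow_neg_rpow_neg (c k : ℝ) {x : ℝ} (hx : 0 < x) :
    (1 + x ^ (-c)) ^ (-k) = (x ^ c / (1 + x ^ c)) ^ k := by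
  have hxc : 0 < x ^ c := Real.rpow_pos_of_pos hx c
  rw [Real.rpow_neg hx.le, Real.rpow_neg (by positivity), ← Real.inv_rpow (by positivity)]
  congr 1
  field_simp
  ring

lemma hasDerivAt_one_add_rpow_neg_rpow_neg (c k : ℝ) {x : ℝ} (hx : 0 < x) :
    HasDerivAt (fun y : ℝ => (1 + y ^ (-c)) ^ (-k))
      (c * k * x ^ (-c - 1) * (1 + x ^ (-c)) ^ (-k - 1)) x := by
  have hxc : 0 < x ^ (-c) := Real.rpow_pos_of_pos hx _
  have h := (((Real.hasDerivAt_rpow_const (p := -c) (Or.inl hx.ne')).const_add 1).rpow_const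
    (p := -k) (Or.inl (by positivity)))
  convert h using 1
  ring

lemma hasDerivAt_exp_neg_div_rpow {lam : ℝ} (beta : ℝ) (hlam : 0 < lam) {x : ℝ} (hx : 0 < x) :
    HasDerivAt (fun y : ℝ => Real.exp (-(y / lam) ^ beta))
      (-(Real.exp (-(x / lam) ^ beta) * (beta / lam ^ beta * x ^ (beta - 1)))) x := by
  have hxl : 0 < x / lam := by positivity
  have h := (((hasDerivAt_id x).div_const lam).rpow_const (p := beta) (Or.inl hxl.ne')).neg.exp
  refine h.congr_deriv ?_
  have hpow : 0 < lam ^ beta := Real.rpow_pos_of_pos hlam _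
  have hrate : 1 / lam * beta * (x / lam) ^ (beta - 1) = beta / lam ^ beta * x ^ (beta - 1) := by
    rw [Real.div_rpow hx.le hlam.le, Real.rpow_sub_one hlam.ne']
    field_simp
  rw [← hrate]
  exact mul_neg _ _

/-- The Burr III–Weibull density
`f_BW(x) = e^{-(x/λ)^β} [ c k x^{-c-1} (1+x^{-c})^{-k-1} + (β/λ^β) x^{β-1} (1 - (1+x^{-c})^{-k}) ]`
integrates to `1` over `(0, ∞)`, i.e. it is a probability density function on `(0, ∞)`. -/
theorem burrIIIWeibull_pdf_integral_eq_one (c k lam beta : ℝ)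
    (hc : 0 < c) (hk : 0 < k) (hlam : 0 < lam) (hbeta : 0 < beta) :
    ∫ x in Set.Ioi (0 : ℝ),
      Real.exp (-(x / lam) ^ beta) *
        (c * k * x ^ (-c - 1) * (1 + x ^ (-c)) ^ (-k - 1) +
          beta / lam ^ beta * x ^ (beta - 1) * (1 - (1 + x ^ (-c)) ^ (-k))) = 1 := by
  have hcont : ContinuousWithinAt
      (fun x : ℝ => -(Real.exp (-(x / lam) ^ beta) * (1 - (x ^ c / (1 + x ^ c)) ^ k)))
      (Ici 0) 0 := by
    apply ContinuousAt.continuousWithinAt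
    have hpow : ContinuousAt (fun x : ℝ => x ^ c) 0 :=
      Real.continuousAt_rpow_const _ _ (Or.inr hc.le)
    have hburr : ContinuousAt (fun x : ℝ => (x ^ c / (1 + x ^ c)) ^ k) 0 :=
      (hpow.div (continuousAt_const.add hpow) (by simp [hc.ne'])).rpow_const (Or.inr hk.le)
    have hweib : ContinuousAt (fun x : ℝ => Real.exp (-(x / lam) ^ beta)) 0 :=
      ((continuousAt_id.div_const lam).rpow_const (Or.inr hbeta.le)).neg.rexp
    exact (hweib.mul (continuousAt_const.sub hburr)).neg
  have hlim : Tendsto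
      (fun x : ℝ => -(Real.exp (-(x / lam) ^ beta) * (1 - (x ^ c / (1 + x ^ c)) ^ k)))
      atTop (𝓝 0) := by
    have hburr : Tendsto (fun x : ℝ => (1 + x ^ (-c)) ^ (-k)) atTop (𝓝 1) := by
      simpa using ((tendsto_rpow_neg_atTop hc).const_add 1).rpow_const (p := -k)
        (Or.inl (by norm_num))
    have hweib : Tendsto (fun x : ℝ => Real.exp (-(x / lam) ^ beta)) atTop (𝓝 0) :=
      Real.tendsto_exp_neg_atTop_nhds_zero.comp
        ((tendsto_rpow_atTop hbeta).comp (tendsto_id.atTop_div_const hlam))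
    have h := (hweib.mul (hburr.const_sub 1)).neg
    simp only [zero_mul, neg_zero] at h
    refine h.congr' ?_
    filter_upwards [eventually_gt_atTop 0] with x hx
    rw [one_add_rpow_neg_rpow_neg c k hx]
  rw [integral_Ioi_of_hasDerivAt_of_nonneg hcont ?_ ?_ hlim]
  · simp [hc.ne', hk.ne', hbeta.ne']
  · intro x hx
    have h := ((hasDerivAt_exp_neg_div_rpow beta hlam hx).mul
      ((hasDerivAt_one_add_rpow_neg_rpow_neg c k hx).const_sub 1)).neg
    refine (h.congr_of_eventuallyEq ?_).congr_deriv (by ring)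
    filter_upwards [eventually_gt_nhds hx] with y hy
    simp [one_add_rpow_neg_rpow_neg c k hy]
  · intro x hx
    have hx : 0 < x := hx
    have hle : (1 + x ^ (-c)) ^ (-k) ≤ 1 :=
      Real.rpow_le_one_of_one_le_of_nonpos
        (le_add_of_nonneg_right (Real.rpow_nonneg hx.le _)) (neg_nonpos.2 hk.le)
    have : 0 ≤ 1 - (1 + x ^ (-c)) ^ (-k) := sub_nonneg.2 hle
    positivity
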